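/- Let m be a positive integer and s a complex number with Re s > 1/2. Then Σ_{C=1}^∞ g(χ₄; 64C; m)/(64C)^{2s} equals (16/64^{2s})·τ(χ₄)·(m/16)^{1−2s}·σ_{2s−1}(χ₄; m/16)/L(χ₄, 2s) if 16 divides m, and equals 0 if 16 does not divide m. Here g(χ₄; q; m) := Σ_{u mod q, gcd(u,q)=1} χ₄(u)·e(m·u/q) and τ(χ₄) := g(χ₄;4;1) = 2i. -/

import Mathlib

open Complex Real MeasureTheory Filter Finset

noncomputable section

/-- The nontrivial Dirichlet character mod 4, extended to `ℤ`, valued in `ℂ`. -/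
def chi4 (m : ℤ) : ℂ := if m % 4 = 1 then 1 else if m % 4 = 3 then -1 else 0

/-- `σ_s(χ₄; n) = ∑_{d ∣ n} χ₄(d) d^s`. -/
def sigmaChi4 (s : ℂ) (n : ℕ) : ℂ := ∑ d ∈ n.divisors, chi4 d * (d : ℂ) ^ s

/-- `σ'_s(χ₄; n) = ∑_{d ∣ n} χ₄(d) d^s log d`. -/
def sigmaChi4' (s : ℂ) (n : ℕ) : ℂ := ∑ d ∈ n.divisors, chi4 d * (d : ℂ) ^ s * (Real.log d : ℂ)

/-- `e(x) = exp(2πix)`. -/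
def e2pi (x : ℂ) : ℂ := Complex.exp (2 * (Real.pi : ℂ) * Complex.I * x)

/-- The Dirichlet L-function of the nontrivial character mod 4. -/
def Lchi4 (s : ℂ) : ℂ :=
  DirichletCharacter.LFunction (ZMod.χ₄.ringHomComp (Int.castRingHom ℂ)) s

/-- Generalized quadratic Gauss sum `G(a, n; q)`. -/
def Gsum (a n : ℤ) (q : ℕ) : ℂ :=
  ∑ x ∈ Finset.range q, e2pi (((a * (x : ℤ) ^ 2 + n * (x : ℤ) : ℤ) : ℂ) / (q : ℂ))

/-- `K(n, l; q) = ∑_{a b ≡ 1 (mod q)} G(a,n;q) G(b,l;q)`. -/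
def Ksum (n l : ℤ) (q : ℕ) : ℂ :=
  ∑ a ∈ Finset.range q, ∑ b ∈ Finset.range q,
    if (a * b) % q = 1 % q then Gsum a n q * Gsum b l q else 0

/-- Kloosterman sum `S(m, n; c)`. -/
def kloosterman (m n : ℤ) (c : ℕ) : ℂ :=
  ∑ x ∈ Finset.range c,
    if Nat.gcd x c = 1 then
      e2pi (((m * (x : ℤ) + n * ((((x : ZMod c)⁻¹).val : ℕ) : ℤ) : ℤ) : ℂ) / (c : ℂ))
    else 0

/-- Ramanujan sum `c_C(m)`. -/
def ramanujanSum (C : ℕ) (m : ℤ) : ℂ :=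
  ∑ D ∈ Finset.range C,
    if Nat.gcd D C = 1 then e2pi (((m * (D : ℤ) : ℤ) : ℂ) / (C : ℂ)) else 0

/-- Gauss sum `g(χ₄; q; m)`. -/
def gaussChi4 (q : ℕ) (m : ℤ) : ℂ :=
  ∑ u ∈ Finset.range q,
    if Nat.gcd u q = 1 then chi4 u * e2pi (((m * (u : ℤ) : ℤ) : ℂ) / (q : ℂ)) else 0

end


lemma aux_sum_mult (d N : ℕ) (hd : 0 < d) (f : ℕ → ℂ) :
    ∑ u ∈ Finset.range (d * N), (if d ∣ u then f u else 0) = ∑ v ∈ Finset.range N, f (d * v) := by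
  rw [← Finset.sum_filter]
  refine Finset.sum_nbij' (fun u => u / d) (fun v => d * v) ?_ ?_ ?_ ?_ ?_
  · intro a ha
    simp only [Finset.mem_filter, Finset.mem_range] at ha ⊢
    exact Nat.div_lt_of_lt_mul ha.1
  · intro a ha
    simp only [Finset.mem_filter, Finset.mem_range] at ha ⊢
    exact ⟨Nat.mul_lt_mul_of_pos_left ha hd, dvd_mul_right _ _⟩
  · intro a ha
    simp only [Finset.mem_filter, Finset.mem_range] at ha ⊢
    exact Nat.mul_div_cancel' ha.2
  · intro a ha
    exact Nat.mul_div_cancel_left _ hd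
  · intro a ha
    simp only [Finset.mem_filter, Finset.mem_range] at ha ⊢
    rw [Nat.mul_div_cancel' ha.2]

lemma aux_sum4 (N : ℕ) (f : ℕ → ℂ) :
    ∑ u ∈ Finset.range (4 * N), f u =
      ∑ b ∈ Finset.range N, (f (4*b) + f (4*b+1) + f (4*b+2) + f (4*b+3)) := by
  induction N with
  | zero => simp
  | succ n ih =>
    rw [Finset.sum_range_succ, ← ih, show 4 * (n+1) = 4*n+1+1+1+1 by ring]
    simp only [Finset.sum_range_succ]
    ring

lemma aux_chi4_eq (n : ℕ) :
    (ZMod.χ₄.ringHomComp (Int.castRingHom ℂ)) (n : ZMod 4) = chi4 (n : ℤ) := by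
  rw [MulChar.ringHomComp_apply, ZMod.χ₄_nat_eq_if_mod_four]
  unfold chi4
  have h4 : n % 4 < 4 := Nat.mod_lt _ (by norm_num)
  split_ifs <;> first | omega | simp

lemma aux_chi4_mul (a b : ℕ) : chi4 ((a * b : ℕ) : ℤ) = chi4 a * chi4 b := by
  rw [← aux_chi4_eq, ← aux_chi4_eq, ← aux_chi4_eq, Nat.cast_mul, map_mul]

lemma aux_moebius (n : ℕ) :
    ∑ d ∈ n.divisors, (ArithmeticFunction.moebius d : ℂ) = if n = 1 then 1 else 0 := by
  have := congrArg (fun f : ArithmeticFunction ℤ => f n) ArithmeticFunction.moebius_mul_coe_zeta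
  simp only [ArithmeticFunction.coe_mul_zeta_apply, ArithmeticFunction.one_apply] at this
  exact_mod_cast this

/-- full sum -/
noncomputable def auxH (m k : ℕ) : ℂ :=
  ∑ u ∈ Finset.range (64 * k), chi4 u * e2pi (((m * (u : ℤ) : ℤ) : ℂ) / ((64 * k : ℕ) : ℂ))

lemma aux_G (m n : ℕ) (hn : 0 < n) : gaussChi4 (64 * n) m =
    ∑ d ∈ n.divisors, chi4 d * (ArithmeticFunction.moebius d : ℂ) * auxH m (n / d) := by
  have h1 : gaussChi4 (64 * n) m = ∑ u ∈ Finset.range (64 * n), ∑ d ∈ n.divisors,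
      (if d ∣ u then (ArithmeticFunction.moebius d : ℂ) *
        (chi4 u * e2pi (((m * (u : ℤ) : ℤ) : ℂ) / ((64 * n : ℕ) : ℂ))) else 0) := by
    unfold gaussChi4
    refine Finset.sum_congr rfl fun u _ => ?_
    have h2 : ∑ d ∈ n.divisors, (if d ∣ u then (ArithmeticFunction.moebius d : ℂ) *
        (chi4 u * e2pi (((m * (u : ℤ) : ℤ) : ℂ) / ((64 * n : ℕ) : ℂ))) else 0)
        = (if Nat.gcd u n = 1 then 1 else 0) *
        (chi4 u * e2pi (((m * (u : ℤ) : ℤ) : ℂ) / ((64 * n : ℕ) : ℂ))) := by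
      rw [← aux_moebius, Finset.sum_mul, ← Finset.sum_filter]
      refine Finset.sum_congr ?_ fun _ _ => rfl
      ext d
      simp only [Finset.mem_filter, Nat.mem_divisors, Nat.dvd_gcd_iff]
      have : Nat.gcd u n ≠ 0 := (Nat.gcd_pos_of_pos_right _ hn).ne'
      have hn' : n ≠ 0 := hn.ne'
      simp only [ne_eq, hn', this, not_false_eq_true, and_true]
      exact and_comm
    rw [h2]
    by_cases hu : u % 2 = 0
    · have : chi4 u = 0 := by unfold chi4; split_ifs <;> first | rfl | omega
      simp [this]
    · have hc : Nat.Coprime u 64 := by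
        have : Nat.Coprime u 2 := by
          rw [Nat.coprime_comm, Nat.prime_two.coprime_iff_not_dvd]; omega
        exact (show (64:ℕ) = 2^6 by norm_num) ▸ this.pow_right 6
      have : Nat.gcd u (64 * n) = Nat.gcd u n := Nat.Coprime.gcd_mul_left_cancel_right n hc.symm
      simp only [this]
      split_ifs <;> simp
  rw [h1, Finset.sum_comm]
  refine Finset.sum_congr rfl fun d hd => ?_
  obtain ⟨⟨k, rfl⟩, _⟩ := Nat.mem_divisors.1 hd
  have hd0 : 0 < d := Nat.pos_of_mul_pos_right hn
  have hk0 : 0 < k := Nat.pos_of_mul_pos_left hn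
  rw [show 64 * (d * k) = d * (64 * k) by ring, aux_sum_mult d _ hd0, Nat.mul_div_cancel_left _ hd0,
    auxH, Finset.mul_sum]
  refine Finset.sum_congr rfl fun v _ => ?_
  rw [aux_chi4_mul]
  have : (((m * ((d * v : ℕ) : ℤ) : ℤ) : ℂ) / ((d * (64 * k) : ℕ) : ℂ))
      = (((m * (v : ℤ) : ℤ) : ℂ) / ((64 * k : ℕ) : ℂ)) := by
    have : (d : ℂ) ≠ 0 := by exact_mod_cast hd0.ne'
    have : (k : ℂ) ≠ 0 := by exact_mod_cast hk0.ne'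
    push_cast
    field_simp
  rw [this]
  ring

lemma aux_e_add (x y : ℂ) : e2pi (x + y) = e2pi x * e2pi y := by
  unfold e2pi; rw [← Complex.exp_add]; ring_nf

lemma aux_e_nat (n : ℕ) (x : ℂ) : e2pi (n * x) = e2pi x ^ n := by
  unfold e2pi; rw [← Complex.exp_nat_mul]; ring_nf

lemma aux_e_one : e2pi 1 = 1 := by
  unfold e2pi; rw [mul_one, Complex.exp_two_pi_mul_I]

lemma aux_e_quarter : e2pi (1/4) = Complex.I := by
  unfold e2pi
  refine Eq.trans ?_ Complex.exp_pi_div_two_mul_I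
  congr 1; ring

lemma aux_H1 (m k : ℕ) (hk : 0 < k) : auxH m k =
    (e2pi (m / (64 * k)) - e2pi (m / (64 * k)) ^ 3) *
      ∑ b ∈ Finset.range (16 * k), (e2pi (m / (16 * k))) ^ b := by
  have hk' : (k : ℂ) ≠ 0 := by exact_mod_cast hk.ne'
  have h4 : e2pi (m / (16 * k)) = e2pi (m / (64 * k)) ^ 4 := by
    rw [← aux_e_nat]; congr 1; push_cast; field_simp; ring
  have he : ∀ u : ℕ, e2pi (((m * (u : ℤ) : ℤ) : ℂ) / ((64 * k : ℕ) : ℂ))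
      = e2pi (m / (64 * k)) ^ u := by
    intro u; rw [← aux_e_nat]; congr 1; push_cast; ring
  rw [auxH, show 64 * k = 4 * (16 * k) by ring, aux_sum4, Finset.mul_sum]
  refine Finset.sum_congr rfl fun b _ => ?_
  rw [show 4 * (16 * k) = 64 * k by ring, he, he, he, he]
  have c0 : chi4 ((4 * b : ℕ) : ℤ) = 0 := by unfold chi4; split_ifs <;> first | rfl | omega
  have c1 : chi4 ((4 * b + 1 : ℕ) : ℤ) = 1 := by unfold chi4; split_ifs <;> first | rfl | omega
  have c2 : chi4 ((4 * b + 2 : ℕ) : ℤ) = 0 := by unfold chi4; split_ifs <;> first | rfl | omega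
  have c3 : chi4 ((4 * b + 3 : ℕ) : ℤ) = -1 := by unfold chi4; split_ifs <;> first | rfl | omega
  rw [c0, c1, c2, c3, h4, ← pow_mul]
  ring

lemma aux_I (n : ℕ) : Complex.I ^ n - (Complex.I ^ n) ^ 3 = 2 * Complex.I * chi4 n := by
  have hI : Complex.I ^ n = Complex.I ^ (n % 4) := (Complex.I_pow_eq_pow_mod n)
  have h4 : n % 4 < 4 := Nat.mod_lt _ (by norm_num)
  have hc : chi4 n = if n % 4 = 1 then 1 else if n % 4 = 3 then -1 else 0 := by
    unfold chi4; split_ifs <;> first | rfl | omega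
  rw [hI, hc]
  have h2 := Complex.I_sq
  have h3 : Complex.I ^ 3 = -Complex.I := Complex.I_pow_three
  interval_cases n % 4
  · simp
  · simp only [pow_one, h3]; simp; ring
  · simp only [h2]; norm_num
  · simp only [h3]; norm_num; linear_combination h3

lemma aux_H0 (m k : ℕ) (hk : 0 < k) (h : ¬ 16 * k ∣ m) : auxH m k = 0 := by
  have hk' : (k : ℂ) ≠ 0 := by exact_mod_cast hk.ne'
  rw [aux_H1 m k hk]
  have hne : e2pi (m / (16 * k)) ≠ 1 := by
    intro he
    unfold e2pi at he
    rw [Complex.exp_eq_one_iff] at he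
    obtain ⟨n, hn⟩ := he
    have hpi : (2 * (Real.pi : ℂ) * Complex.I) ≠ 0 := Complex.two_pi_I_ne_zero
    rw [mul_comm (n : ℂ)] at hn
    have h1 := mul_left_cancel₀ hpi hn
    rw [div_eq_iff (by simpa using hk')] at h1
    apply h
    have h2 : (m : ℤ) = n * (16 * k) := by exact_mod_cast h1
    have : ((16 * k : ℕ) : ℤ) ∣ m := ⟨n, by push_cast; rw [h2]; ring⟩
    exact_mod_cast this
  rw [geom_sum_eq hne, ← aux_e_nat (16 * k)]
  have : ((16 * k : ℕ) : ℂ) * (m / (16 * k)) = m * 1 := by push_cast; field_simp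
  rw [this, aux_e_nat, aux_e_one]
  simp

lemma aux_H2 (n k : ℕ) (hk : 0 < k) : auxH (16 * k * n) k = 32 * Complex.I * k * chi4 n := by
  have hk' : (k : ℂ) ≠ 0 := by exact_mod_cast hk.ne'
  rw [aux_H1 _ k hk]
  have h1 : (((16 * k * n : ℕ) : ℂ) / (16 * k)) = n * 1 := by push_cast; field_simp
  have h2 : (((16 * k * n : ℕ) : ℂ) / (64 * k)) = n * (1 / 4) := by
    push_cast; field_simp; ring
  rw [h1, h2, aux_e_nat, aux_e_nat, aux_e_one, aux_e_quarter, aux_I]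
  simp
  ring

open scoped LSeries.notation in
lemma aux_main (m : ℕ) (hm : 0 < m) (w : ℂ) (hw : 1 < w.re) :
    LSeries (fun n => gaussChi4 (64 * n) m) w = LSeries (auxH m) w / Lchi4 w := by
  set χ : DirichletCharacter ℂ 4 := ZMod.χ₄.ringHomComp (Int.castRingHom ℂ) with hχ
  have hS : LSeriesSummable (auxH m) w := by
    refine summable_of_ne_finset_zero (s := Finset.range (m + 1)) fun k hk => ?_
    rw [LSeries.term_def]
    split_ifs with h0
    · rfl
    · rw [aux_H0 m k (Nat.pos_of_ne_zero h0), zero_div]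
      intro hd
      have := Nat.le_of_dvd hm hd
      simp at hk
      omega
  have hμ := DirichletCharacter.LSeriesSummable_mul χ
    (ArithmeticFunction.LSeriesSummable_moebius_iff.mpr hw)
  have h1 := DirichletCharacter.LSeries.mul_mu_eq_one χ hw
  have h2 : Lchi4 w = LSeries (fun n : ℕ => χ n) w := DirichletCharacter.LFunction_eq_LSeries χ hw
  have h0 := DirichletCharacter.LSeries_ne_zero_of_one_lt_re χ hw
  rw [h2, eq_div_iff h0]
  have h3 := LSeries_convolution' hμ hS
  have h4 : LSeries (fun n => gaussChi4 (64 * n) m) w = LSeries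
      (LSeries.convolution ((fun n : ℕ => χ n) * fun n => (ArithmeticFunction.moebius n : ℂ))
        (auxH m)) w := by
    refine LSeries_congr (fun {n} hn => ?_) w
    rw [aux_G m n (Nat.pos_of_ne_zero hn), LSeries.convolution_def]
    simp only [Pi.mul_apply]
    rw [Nat.sum_divisorsAntidiagonal
      (fun a b => χ (a : ZMod 4) * (ArithmeticFunction.moebius a : ℂ) * auxH m b)]
    refine Finset.sum_congr rfl fun d _ => ?_
    rw [hχ, aux_chi4_eq]
  rw [h4, h3]
  linear_combination (LSeries (auxH m) w) * h1

lemma aux_LH (M : ℕ) (hM : 0 < M) (w : ℂ) : LSeries (auxH (16 * M)) w =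
    32 * Complex.I * (M : ℂ) ^ (1 - w) * sigmaChi4 (w - 1) M := by
  rw [LSeries, tsum_eq_sum (s := M.divisors), ← Nat.sum_div_divisors, sigmaChi4, Finset.mul_sum]
  · refine Finset.sum_congr rfl fun d hd => ?_
    obtain ⟨⟨k, rfl⟩, _⟩ := Nat.mem_divisors.1 hd
    have hd0 : 0 < d := Nat.pos_of_mul_pos_right hM
    have hk0 : 0 < k := Nat.pos_of_mul_pos_left hM
    have hdC : (d : ℂ) ≠ 0 := by exact_mod_cast hd0.ne'
    have hkC : (k : ℂ) ≠ 0 := by exact_mod_cast hk0.ne'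
    rw [Nat.mul_div_cancel_left _ hd0, LSeries.term_of_ne_zero hk0.ne',
      show 16 * (d * k) = 16 * k * d by ring, aux_H2 d k hk0, Nat.cast_mul,
      Complex.natCast_mul_natCast_cpow]
    have e1 : (d : ℂ) ^ (1 - w) * (d : ℂ) ^ (w - 1) = 1 := by
      rw [← Complex.cpow_add _ _ hdC]; simp
    have e2 : (k : ℂ) ^ (1 - w) = k / (k : ℂ) ^ w := by
      rw [Complex.cpow_sub _ _ hkC, Complex.cpow_one]
    rw [e2]
    linear_combination (-32 * Complex.I * (k / (k : ℂ) ^ w) * chi4 d) * e1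
  · intro k hk
    rw [LSeries.term_def]
    split_ifs with h0
    · rfl
    · rw [aux_H0 _ k (Nat.pos_of_ne_zero h0), zero_div]
      intro hd
      exact hk (Nat.mem_divisors.2 ⟨Nat.dvd_of_mul_dvd_mul_left (by norm_num) hd, hM.ne'⟩)

/-- Dirichlet series of the Gauss sums `g(χ₄; 64C; m)`. -/
theorem tsum_gaussChi4_64 (m : ℕ) (hm : 0 < m) (s : ℂ) (hs : 1 / 2 < s.re) :
    ∑' C : ℕ+, gaussChi4 (64 * (C : ℕ)) (m : ℤ) / ((64 * (C : ℕ) : ℕ) : ℂ) ^ (2 * s) =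
      if 16 ∣ m then
        (16 / (64 : ℂ) ^ (2 * s)) * (2 * Complex.I) *
          ((m / 16 : ℕ) : ℂ) ^ (1 - 2 * s) * sigmaChi4 (2 * s - 1) (m / 16) / Lchi4 (2 * s)
      else 0 := by
  have hw : 1 < (2 * s).re := by simp; linarith
  have h1 : ∑' C : ℕ+, gaussChi4 (64 * (C : ℕ)) (m : ℤ) / ((64 * (C : ℕ) : ℕ) : ℂ) ^ (2 * s)
      = (1 / (64 : ℂ) ^ (2 * s)) * LSeries (fun n => gaussChi4 (64 * n) m) (2 * s) := by
    rw [LSeries, ← tsum_mul_left, ← PNat.coe_injective.tsum_eq]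
    · refine tsum_congr fun C => ?_
      rw [LSeries.term_of_ne_zero C.ne_zero, Nat.cast_mul, Complex.natCast_mul_natCast_cpow]
      push_cast
      rw [one_div, ← div_eq_inv_mul, div_div, mul_comm ((C : ℂ) ^ (2 * s))]
    · intro n hn
      by_cases h0 : n = 0
      · simp [h0] at hn
      · exact ⟨⟨n, Nat.pos_of_ne_zero h0⟩, rfl⟩
  rw [h1, aux_main m hm _ hw]
  split_ifs with h
  · obtain ⟨M, rfl⟩ := h
    rw [Nat.mul_div_cancel_left _ (by norm_num), aux_LH M (by omega)]
    ring
  · have : LSeries (auxH m) (2 * s) = 0 := by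
      rw [LSeries]
      refine (tsum_congr fun k => ?_).trans tsum_zero
      rw [LSeries.term_def]
      split_ifs with h0
      · rfl
      · rw [aux_H0 _ k (Nat.pos_of_ne_zero h0) fun hd => h ((dvd_mul_right _ _).trans hd), zero_div]
    rw [this]
    simp
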